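/- Let θ : ℝ → ℂ have a distributional derivative θ' with ∫_ℝ |θ(x)| e^{β|x|/2} dx < ∞, ∫_ℝ |θ'(x)| e^{β|x|/2} dx < ∞ and ∫_ℝ θ(x) dx = 0, and define ψ̂(ξ) = exp(∫_0^1 θ̂(ξs)/s ds) for ξ ∈ ℝ. Then there is a bounded linear operator Ψ on ℰ determined by ℱ[Ψf](ξ) = ψ̂(ξ) f̂(ξ) for a.e. ξ ∈ ℝ; Ψ is a bijection of ℰ onto itself whose inverse is the bounded operator determined by ℱ[Ψ^{−1}f](ξ) = f̂(ξ)/ψ̂(ξ); and for every k ∈ ℕ₀ one has Ψ(ℰ_k) = ℰ_k. -/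

import Mathlib

open MeasureTheory Complex
open scoped ContDiff ENNReal

/-- The weighted measure `cosh(βx) dx` on `ℝ`. -/
noncomputable def muE (β : ℝ) : Measure ℝ :=
  volume.withDensity fun x => ENNReal.ofReal (Real.cosh (β * x))

/-- Fourier transform with the paper's normalization, at a real frequency. -/
noncomputable def FT (f : ℝ → ℂ) (ξ : ℝ) : ℂ :=
  ∫ x : ℝ, f x * Complex.exp (-(Complex.I * x * ξ))

/-- `f'` is the distributional derivative of `f`. -/
def IsDistribDeriv (f f' : ℝ → ℂ) : Prop :=
  ∀ φ : ℝ → ℂ, ContDiff ℝ ∞ φ → HasCompactSupport φ →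
    ∫ x : ℝ, f x * deriv φ x = -∫ x : ℝ, f' x * φ x

/-- `ψ̂(ξ) = exp(∫_0^1 θ̂(ξs)/s ds)`. -/
noncomputable def psihat (θ : ℝ → ℂ) (ξ : ℝ) : ℂ :=
  Complex.exp (∫ s in (0:ℝ)..1, FT θ (ξ * s) / s)

/-- The subset `ℰ_k` of `ℰ`: all moments of order `< k` vanish. -/
def Ek (β : ℝ) (k : ℕ) : Set (Lp ℂ 2 (muE β)) :=
  {f : Lp ℂ 2 (muE β) | ∀ j < k, ∫ x : ℝ, f x * (x : ℂ) ^ j = 0}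

section Plancherel

open scoped FourierTransform InnerProductSpace

/-- Multiplication by an essentially bounded function, as a bounded operator on `L²`. -/
noncomputable def mulOp {α : Type*} [MeasurableSpace α] {μ : Measure α} (g : α → ℂ)
    (hg : MemLp g ∞ μ) : Lp ℂ 2 μ →L[ℂ] Lp ℂ 2 μ :=
  (ContinuousLinearMap.mul ℂ ℂ).holderL μ ∞ 2 2 hg.toLp

theorem coeFn_mulOp {α : Type*} [MeasurableSpace α] {μ : Measure α} (g : α → ℂ)
    (hg : MemLp g ∞ μ) (u : Lp ℂ 2 μ) : mulOp g hg u =ᵐ[μ] fun x => g x * u x := by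
  have h := (ContinuousLinearMap.mul ℂ ℂ).coeFn_holder (r := 2) hg.toLp u
  filter_upwards [h, hg.coeFn_toLp] with x hx hx'
  simpa [mulOp, hx'] using hx

theorem memLp_top_modulation (y : ℝ) :
    MemLp (fun η : ℝ => Complex.exp (-(I * (2 * Real.pi * η) * y))) ∞ volume := by
  refine memLp_top_of_bound (by fun_prop) 1 (.of_forall fun η => ?_)
  rw [Complex.norm_exp]
  simp

/-- Translation on `L²(ℝ)`. -/
noncomputable def translateLp (y : ℝ) :
    Lp ℂ 2 (volume : Measure ℝ) →ₗᵢ[ℂ] Lp ℂ 2 (volume : Measure ℝ) :=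
  Lp.compMeasurePreservingₗᵢ ℂ (fun x => x - y) (measurePreserving_sub_right volume y)

theorem coeFn_translateLp (y : ℝ) (u : Lp ℂ 2 (volume : Measure ℝ)) :
    translateLp y u =ᵐ[volume] fun x => u (x - y) :=
  Lp.coeFn_compMeasurePreserving u (measurePreserving_sub_right volume y)

theorem fourier_translate (y : ℝ) (u : Lp ℂ 2 (volume : Measure ℝ)) :
    𝓕 (translateLp y u) = mulOp _ (memLp_top_modulation y) (𝓕 u) := by
  refine DenseRange.induction_on
    (p := fun u => 𝓕 (translateLp y u) = mulOp _ (memLp_top_modulation y) (𝓕 u))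
    (SchwartzMap.denseRange_toLpCLM (F := ℂ) (E := ℝ) (μ := volume) (p := 2) (by simp)) u ?_ ?_
  · exact isClosed_eq
      ((Lp.fourierTransformₗᵢ ℝ ℂ).continuous.comp (translateLp y).continuous)
      ((mulOp _ (memLp_top_modulation y)).continuous.comp (Lp.fourierTransformₗᵢ ℝ ℂ).continuous)
  intro φ
  have h1 : translateLp y (φ.toLp 2 volume)
      = (SchwartzMap.compSubConstCLM ℂ y φ).toLp 2 volume := by
    apply Lp.ext
    have hq := (measurePreserving_sub_right volume y).quasiMeasurePreserving.ae_eq_comp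
      (SchwartzMap.coeFn_toLp φ 2 volume)
    filter_upwards [coeFn_translateLp y (φ.toLp 2 volume), hq,
      SchwartzMap.coeFn_toLp (SchwartzMap.compSubConstCLM ℂ y φ) 2 volume] with x h1 h2 h3
    rw [h1, h3]
    exact h2
  change 𝓕 (translateLp y (φ.toLp 2 volume))
    = mulOp _ (memLp_top_modulation y) (𝓕 (φ.toLp 2 volume))
  rw [h1, SchwartzMap.toLp_fourier_eq, SchwartzMap.toLp_fourier_eq]
  apply Lp.ext
  filter_upwards [SchwartzMap.coeFn_toLp (𝓕 (SchwartzMap.compSubConstCLM ℂ y φ)) 2 volume,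
    coeFn_mulOp _ (memLp_top_modulation y) ((𝓕 φ).toLp 2 volume),
    SchwartzMap.coeFn_toLp (𝓕 φ) 2 volume] with x h1 h2 h3
  rw [h1, h2, h3]
  rw [SchwartzMap.fourier_coe, SchwartzMap.fourier_coe, Real.fourier_eq', Real.fourier_eq',
    ← integral_const_mul, ← integral_add_right_eq_self _ y]
  congr 1 with t
  simp only [SchwartzMap.compSubConstCLM_apply, add_sub_cancel_right, smul_eq_mul]
  rw [← mul_assoc, ← Complex.exp_add]
  congr 2
  simp
  ring

theorem integral_fourier_mul_modulation (u v : Lp ℂ 2 (volume : Measure ℝ)) (y : ℝ) :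
    ∫ η : ℝ, (starRingEnd ℂ) ((𝓕 v : Lp ℂ 2 (volume : Measure ℝ)) η) *
        (𝓕 u : Lp ℂ 2 (volume : Measure ℝ)) η * Complex.exp (-(I * (2 * Real.pi * η) * y))
      = ∫ x : ℝ, (starRingEnd ℂ) (v x) * u (x - y) := by
  have h := Lp.inner_fourier_eq v (translateLp y u)
  rw [fourier_translate, L2.inner_def, L2.inner_def] at h
  convert h using 1
  · apply integral_congr_ae
    filter_upwards [coeFn_mulOp _ (memLp_top_modulation y) (𝓕 u)] with x hx
    rw [hx, RCLike.inner_apply']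
    ring
  · apply integral_congr_ae
    filter_upwards [coeFn_translateLp y u] with x hx
    rw [hx, RCLike.inner_apply']

end Plancherel

section WeightedSpace

theorem exp_abs_le_two_mul_cosh (β x : ℝ) : Real.exp (β * |x|) ≤ 2 * Real.cosh (β * x) := by
  rw [Real.cosh_eq]
  rcases abs_cases x with ⟨h, _⟩ | ⟨h, _⟩ <;> rw [h]
  · linarith [Real.exp_pos (-(β * x))]
  · rw [mul_neg]; linarith [Real.exp_pos (β * x)]

theorem mul_le_of_abs_le {a b : ℝ} (h : |a| ≤ b) (x : ℝ) : a * x ≤ b * |x| :=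
  (le_abs_self _).trans <| by rw [abs_mul]; gcongr

theorem measurable_ofReal_cosh (β : ℝ) :
    Measurable fun x : ℝ => ENNReal.ofReal (Real.cosh (β * x)) := by
  fun_prop

theorem muE_absolutelyContinuous (β : ℝ) : muE β ≪ volume :=
  withDensity_absolutelyContinuous _ _

theorem absolutelyContinuous_muE (β : ℝ) : volume ≪ muE β :=
  withDensity_absolutelyContinuous' (measurable_ofReal_cosh β).aemeasurable
    (.of_forall fun x => by simpa using Real.cosh_pos _)

theorem integrable_muE_iff {E : Type*} [NormedAddCommGroup E] [NormedSpace ℝ E] (β : ℝ)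
    (g : ℝ → E) :
    Integrable g (muE β) ↔ Integrable (fun x => Real.cosh (β * x) • g x) := by
  rw [muE, integrable_withDensity_iff_integrable_smul' (measurable_ofReal_cosh β)
    (.of_forall fun x => ENNReal.ofReal_lt_top)]
  simp [ENNReal.toReal_ofReal (Real.cosh_pos _).le]

theorem integral_muE {E : Type*} [NormedAddCommGroup E] [NormedSpace ℝ E] (β : ℝ)
    (g : ℝ → E) : ∫ x, g x ∂(muE β) = ∫ x, Real.cosh (β * x) • g x := by
  rw [muE, integral_withDensity_eq_integral_toReal_smul (measurable_ofReal_cosh β)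
    (.of_forall fun x => ENNReal.ofReal_lt_top)]
  simp [ENNReal.toReal_ofReal (Real.cosh_pos _).le]

theorem integrable_exp_neg_mul_abs {b : ℝ} (hb : 0 < b) :
    Integrable fun x : ℝ => Real.exp (-(b * |x|)) := by
  have h := (exp_neg_integrableOn_Ioi 0 hb)
  have h1 : IntegrableOn (fun x : ℝ => Real.exp (-(b * |x|))) (Set.Ioi 0) :=
    h.congr_fun (fun x hx => by simp [abs_of_pos (Set.mem_Ioi.1 hx)]) measurableSet_Ioi
  have h2 : IntegrableOn (fun x : ℝ => Real.exp (-(b * |x|))) (Set.Iic 0) := by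
    rw [integrableOn_Iic_iff_integrableOn_Iio]
    simpa using h1.comp_neg
  rw [← integrableOn_univ, ← Set.Iic_union_Ioi (a := (0 : ℝ))]
  exact h2.union h1

/-- A function of growth strictly slower than `exp (β |x| / 2)`, divided by the weight, lies in the
weighted `L²` space. -/
theorem memLp_div_cosh {β γ C : ℝ} (hγ : 2 * γ < β) {w : ℝ → ℂ}
    (hw : AEStronglyMeasurable w) (hC : ∀ x, ‖w x‖ ≤ C * Real.exp (γ * |x|)) :
    MemLp (fun x => w x / (Real.cosh (β * x) : ℂ)) 2 (muE β) := by
  have hcont : Continuous fun x : ℝ => Real.cosh (β * x) := by fun_prop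
  have hm : AEStronglyMeasurable fun x => w x / (Real.cosh (β * x) : ℂ) :=
    (hw.aemeasurable.div (by fun_prop)).aestronglyMeasurable
  rw [memLp_two_iff_integrable_sq_norm (hm.mono_ac (muE_absolutelyContinuous β)),
    integrable_muE_iff]
  refine Integrable.mono' ((integrable_exp_neg_mul_abs
    (b := β - 2 * γ) (by linarith)).const_mul (2 * C ^ 2)) ?_ (.of_forall fun x => ?_)
  · exact hcont.aestronglyMeasurable.smul (hm.norm.pow 2)
  have hc := Real.cosh_pos (β * x)
  have h1 := exp_abs_le_two_mul_cosh β x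
  have h2 : ‖w x‖ ^ 2 ≤ C ^ 2 * Real.exp (2 * (γ * |x|)) := by
    calc ‖w x‖ ^ 2 ≤ (C * Real.exp (γ * |x|)) ^ 2 := by gcongr; exact hC x
      _ = _ := by rw [mul_pow, ← Real.exp_nat_mul]; rfl
  rw [Real.norm_of_nonneg (by positivity), norm_div, Complex.norm_real,
    Real.norm_of_nonneg hc.le, smul_eq_mul]
  have h3 : Real.cosh (β * x) * (‖w x‖ / Real.cosh (β * x)) ^ 2
      = ‖w x‖ ^ 2 / Real.cosh (β * x) := by field_simp
  rw [h3, div_le_iff₀ hc]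
  calc ‖w x‖ ^ 2 ≤ C ^ 2 * Real.exp (2 * (γ * |x|)) := h2
    _ = C ^ 2 * Real.exp (-((β - 2 * γ) * |x|)) * Real.exp (β * |x|) := by
      rw [mul_assoc, ← Real.exp_add]; congr 2; ring
    _ ≤ C ^ 2 * Real.exp (-((β - 2 * γ) * |x|)) * (2 * Real.cosh (β * x)) := by gcongr
    _ = _ := by ring

theorem inner_toLp_div_cosh {β : ℝ} {w : ℝ → ℂ}
    (hw : MemLp (fun x => w x / (Real.cosh (β * x) : ℂ)) 2 (muE β)) (f : Lp ℂ 2 (muE β)) :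
    Integrable (fun x => (starRingEnd ℂ) (w x) * f x) ∧
      inner ℂ (hw.toLp) f = ∫ x, (starRingEnd ℂ) (w x) * f x := by
  have hae : (fun x => Real.cosh (β * x) • inner ℂ ((hw.toLp) x) (f x))
      =ᵐ[volume] fun x => (starRingEnd ℂ) (w x) * f x := by
    filter_upwards [(absolutelyContinuous_muE β).ae_eq hw.coeFn_toLp] with x hx
    have hc : (Real.cosh (β * x) : ℂ) ≠ 0 := by exact_mod_cast (Real.cosh_pos _).ne'
    rw [hx, RCLike.inner_apply', map_div₀, Complex.conj_ofReal, Complex.real_smul]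
    field_simp
  constructor
  · exact ((integrable_muE_iff _ _).1 (L2.integrable_inner (𝕜 := ℂ) (hw.toLp) f)).congr hae
  · rw [L2.inner_def, integral_muE, integral_congr_ae hae]

theorem norm_sq_Lp_two {α : Type*} [MeasurableSpace α] {μ : Measure α} (f : Lp ℂ 2 μ) :
    Integrable (fun x => ‖f x‖ ^ 2) μ ∧ ‖f‖ ^ 2 = ∫ x, ‖f x‖ ^ 2 ∂μ := by
  refine ⟨(memLp_two_iff_integrable_sq_norm (Lp.aestronglyMeasurable f)).1 (Lp.memLp f), ?_⟩
  have h := L2.inner_def (𝕜 := ℂ) f f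
  simp only [inner_self_eq_norm_sq_to_K] at h
  have h' : ((‖f‖ ^ 2 : ℝ) : ℂ) = ((∫ x, ‖f x‖ ^ 2 ∂μ : ℝ) : ℂ) := by
    rw [← integral_complex_ofReal]
    simpa using h
  exact_mod_cast h'

theorem exp_mul_norm_sq_le {β a : ℝ} (ha : |a| ≤ β / 2) (z : ℂ) (x : ℝ) :
    ‖(Real.exp (a * x) : ℂ) * z‖ ^ 2 ≤ 2 * (Real.cosh (β * x) * ‖z‖ ^ 2) := by
  rw [norm_mul, mul_pow, Complex.norm_real, Real.norm_of_nonneg (Real.exp_pos _).le,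
    ← Real.exp_nat_mul, ← mul_assoc 2 (Real.cosh _)]
  refine mul_le_mul_of_nonneg_right ?_ (sq_nonneg _)
  refine (Real.exp_le_exp.2 ?_).trans (exp_abs_le_two_mul_cosh β x)
  have := mul_le_of_abs_le ha x
  push_cast
  linarith

theorem memLp_exp_mul {β a : ℝ} (ha : |a| ≤ β / 2) (f : Lp ℂ 2 (muE β)) :
    MemLp (fun x : ℝ => (Real.exp (a * x) : ℂ) * f x) 2 volume := by
  have hm : AEStronglyMeasurable fun x : ℝ => (Real.exp (a * x) : ℂ) * f x :=
    (Continuous.aestronglyMeasurable (by fun_prop)).mul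
      ((Lp.aestronglyMeasurable f).mono_ac (absolutelyContinuous_muE β))
  rw [memLp_two_iff_integrable_sq_norm hm]
  refine Integrable.mono' (((integrable_muE_iff β _).1 (norm_sq_Lp_two f).1).const_mul 2)
    (hm.norm.pow 2) (.of_forall fun x => ?_)
  rw [Real.norm_of_nonneg (by positivity)]
  exact exp_mul_norm_sq_le ha _ x

/-- Multiplication by `exp (a x)`, from the weighted space to `L²(ℝ)`. -/
noncomputable def expWeight {β a : ℝ} (ha : |a| ≤ β / 2) :
    Lp ℂ 2 (muE β) →L[ℂ] Lp ℂ 2 (volume : Measure ℝ) :=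
  LinearMap.mkContinuous
    { toFun := fun f => (memLp_exp_mul ha f).toLp
      map_add' := fun f g => by
        rw [← MemLp.toLp_add]
        apply MemLp.toLp_congr
        filter_upwards [(absolutelyContinuous_muE β).ae_eq (Lp.coeFn_add f g)] with x hx
        rw [hx, Pi.add_apply, Pi.add_apply, mul_add]
      map_smul' := fun c f => by
        rw [RingHom.id_apply, ← MemLp.toLp_const_smul]
        apply MemLp.toLp_congr
        filter_upwards [(absolutelyContinuous_muE β).ae_eq (Lp.coeFn_smul c f)] with x hx
        rw [hx, Pi.smul_apply, Pi.smul_apply, smul_eq_mul, smul_eq_mul, mul_left_comm] } 2 fun f => by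
    refine le_of_sq_le_sq ?_ (by positivity)
    rw [mul_pow, (norm_sq_Lp_two f).2, (norm_sq_Lp_two _).2, integral_muE, ← integral_const_mul]
    have h := (integrable_muE_iff β _).1 (norm_sq_Lp_two f).1
    refine integral_mono_ae (norm_sq_Lp_two _).1 (h.const_mul _) ?_
    filter_upwards [(memLp_exp_mul ha f).coeFn_toLp] with x hx
    have hx' := exp_mul_norm_sq_le ha (f x) x
    have h0 : 0 ≤ Real.cosh (β * x) * ‖f x‖ ^ 2 :=
      mul_nonneg (Real.cosh_pos _).le (by positivity)
    simp only [LinearMap.coe_mk, AddHom.coe_mk, smul_eq_mul]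
    rw [hx]
    linarith

theorem coeFn_expWeight {β a : ℝ} (ha : |a| ≤ β / 2) (f : Lp ℂ 2 (muE β)) :
    expWeight ha f =ᵐ[volume] fun x => (Real.exp (a * x) : ℂ) * f x :=
  (memLp_exp_mul ha f).coeFn_toLp

end WeightedSpace

section ComplexFourier

/-- The Fourier transform at a complex frequency. -/
noncomputable def complexFT (g : ℝ → ℂ) (z : ℂ) : ℂ :=
  ∫ x : ℝ, g x * Complex.exp (-(I * x * z))

theorem norm_exp_neg_I_mul (x : ℝ) (z : ℂ) :
    ‖Complex.exp (-(I * x * z))‖ = Real.exp (x * z.im) := by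
  rw [Complex.norm_exp]
  simp

theorem norm_exp_neg_I_mul_le {b : ℝ} {z : ℂ} (hz : |z.im| ≤ b) (x : ℝ) :
    ‖Complex.exp (-(I * x * z))‖ ≤ Real.exp (b * |x|) := by
  rw [norm_exp_neg_I_mul, mul_comm]
  exact Real.exp_le_exp.2 (mul_le_of_abs_le hz x)

variable {β : ℝ} {g : ℝ → ℂ}

theorem norm_mul_exp_le {z : ℂ} (hz : |z.im| ≤ β / 2) (x : ℝ) :
    ‖g x * Complex.exp (-(I * x * z))‖ ≤ ‖g x‖ * Real.exp (β * |x| / 2) := by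
  rw [norm_mul, show β * |x| / 2 = β / 2 * |x| by ring]
  gcongr
  exact norm_exp_neg_I_mul_le hz x

theorem aestronglyMeasurable_mul_exp (hm : AEStronglyMeasurable g) (z : ℂ) :
    AEStronglyMeasurable fun x : ℝ => g x * Complex.exp (-(I * x * z)) :=
  hm.mul (Continuous.aestronglyMeasurable (by fun_prop))

theorem integrable_mul_exp (hm : AEStronglyMeasurable g)
    (hg : Integrable (fun x : ℝ => ‖g x‖ * Real.exp (β * |x| / 2)))
    {z : ℂ} (hz : |z.im| ≤ β / 2) :
    Integrable fun x : ℝ => g x * Complex.exp (-(I * x * z)) :=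
  hg.mono' (aestronglyMeasurable_mul_exp hm z) (.of_forall (norm_mul_exp_le hz))

theorem norm_complexFT_le (hg : Integrable (fun x : ℝ => ‖g x‖ * Real.exp (β * |x| / 2)))
    {z : ℂ} (hz : |z.im| ≤ β / 2) :
    ‖complexFT g z‖ ≤ ∫ x : ℝ, ‖g x‖ * Real.exp (β * |x| / 2) :=
  norm_integral_le_of_norm_le hg (.of_forall (norm_mul_exp_le hz))

theorem norm_complexFT_le_mul_norm (hβ : 0 < β) (hm : AEStronglyMeasurable g)
    (hg : Integrable (fun x : ℝ => ‖g x‖ * Real.exp (β * |x| / 2)))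
    (hmass : ∫ x : ℝ, g x = 0) {z : ℂ} (hz : |z.im| ≤ β / 4) :
    ‖complexFT g z‖ ≤ 4 / β * (∫ x : ℝ, ‖g x‖ * Real.exp (β * |x| / 2)) * ‖z‖ := by
  have h0 : Integrable g := by
    simpa using integrable_mul_exp hm hg (z := 0) (by simpa using by positivity)
  have h1 := integrable_mul_exp hm hg (z := z) (by linarith)
  have h2 : complexFT g z = ∫ x : ℝ, g x * (Complex.exp (-(I * x * z)) - 1) := by
    simp only [mul_sub, mul_one]
    rw [integral_sub h1 h0, hmass, sub_zero, complexFT]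
  rw [h2, mul_right_comm, ← integral_const_mul]
  refine norm_integral_le_of_norm_le (hg.const_mul _) (.of_forall fun x => ?_)
  have h3 : ‖Complex.exp (-(I * x * z)) - 1‖ ≤ ‖z‖ * |x| * Real.exp (β / 4 * |x|) := by
    have hd : ∀ t ∈ Set.Icc (0 : ℝ) 1, HasDerivWithinAt
        (fun t : ℝ => Complex.exp (-(I * x * z) * t))
        (Complex.exp (-(I * x * z) * t) * -(I * x * z)) (Set.Icc 0 1) t := fun t _ => by
      have := (((hasDerivAt_id (t : ℂ)).const_mul (-(I * x * z))).cexp.comp_ofReal)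
      simpa using this.hasDerivWithinAt
    have := norm_image_sub_le_of_norm_deriv_le_segment_01' hd
      (C := ‖z‖ * |x| * Real.exp (β / 4 * |x|)) ?_
    · simpa using this
    intro t ht
    have h4 : -(I * x * z) * t = -(I * x * (t * z)) := by ring
    rw [norm_mul, h4, mul_comm]
    have h5 : ‖-(I * x * z)‖ = ‖z‖ * |x| := by simp [mul_comm]
    rw [h5]
    gcongr
    refine norm_exp_neg_I_mul_le ?_ x
    rw [Complex.im_ofReal_mul, abs_mul, abs_of_nonneg ht.1]
    calc t * |z.im| ≤ 1 * |z.im| := by gcongr; exact ht.2.le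
      _ ≤ _ := by simpa using hz
  rw [norm_mul]
  have h6 : |x| ≤ 4 / β * Real.exp (β / 4 * |x|) := by
    have := Real.add_one_le_exp (β / 4 * |x|)
    calc |x| = 4 / β * (β / 4 * |x|) := by field_simp
      _ ≤ _ := by gcongr; linarith
  calc ‖g x‖ * ‖Complex.exp (-(I * x * z)) - 1‖
      ≤ ‖g x‖ * (‖z‖ * (4 / β * Real.exp (β / 4 * |x|)) * Real.exp (β / 4 * |x|)) := by
        gcongr
        exact h3.trans (by gcongr)
    _ = 4 / β * ‖z‖ * (‖g x‖ * (Real.exp (β / 4 * |x|) * Real.exp (β / 4 * |x|))) := by ring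
    _ = _ := by rw [← Real.exp_add]; congr 4; ring

theorem exists_smooth_cutoff : ∃ (χ : ℝ → ℝ) (K : ℝ), ContDiff ℝ ∞ χ ∧ HasCompactSupport χ ∧
    (∀ x, |χ x| ≤ 1) ∧ (∀ x, |deriv χ x| ≤ K) ∧ χ 0 = 1 := by
  let b : ContDiffBump (0 : ℝ) := ⟨1, 2, one_pos, one_lt_two⟩
  have hc : ContDiff ℝ ∞ b := b.contDiff
  obtain ⟨K, hK⟩ := (b.hasCompactSupport.deriv).exists_bound_of_continuous
    (hc.continuous_deriv (by simp))
  refine ⟨b, K, hc, b.hasCompactSupport, fun x => ?_, hK, ?_⟩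
  · rw [abs_of_nonneg b.nonneg]; exact b.le_one
  · exact b.one_of_mem_closedBall (by simp [b])

theorem mul_complexFT_eq {g' : ℝ → ℂ} (hm : AEStronglyMeasurable g)
    (hm' : AEStronglyMeasurable g') (hderiv : IsDistribDeriv g g')
    (hg : Integrable (fun x : ℝ => ‖g x‖ * Real.exp (β * |x| / 2)))
    (hg' : Integrable (fun x : ℝ => ‖g' x‖ * Real.exp (β * |x| / 2)))
    {z : ℂ} (hz : |z.im| ≤ β / 2) :
    I * z * complexFT g z = complexFT g' z := by
  obtain ⟨χ, K, hχ, hχs, hχ1, hχK, hχ0⟩ := exists_smooth_cutoff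
  let r : ℕ → ℝ := fun n => 1 / ((n : ℝ) + 1)
  have hr0 : ∀ n, r n ≠ 0 := fun n => by positivity
  have hr1 : ∀ n, |r n| ≤ 1 := fun n => by
    rw [abs_of_nonneg (by positivity)]
    exact div_le_one_of_le₀ (by linarith [(Nat.cast_nonneg n : (0 : ℝ) ≤ n)]) (by positivity)
  have hr : Filter.Tendsto r Filter.atTop (nhds 0) := tendsto_one_div_add_atTop_nhds_zero_nat
  let e : ℝ → ℂ := fun x => Complex.exp (-(I * x * z))
  have he : ContDiff ℝ ∞ e := by
    have : ContDiff ℝ ∞ fun x : ℝ => (x : ℂ) := Complex.ofRealCLM.contDiff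
    exact ((contDiff_const.mul this).mul contDiff_const).neg.cexp
  have hed : ∀ x, HasDerivAt e (-(I * z) * e x) x := fun x => by
    have h := ((((hasDerivAt_id (x : ℂ)).const_mul I).mul_const z).neg).cexp.comp_ofReal
    refine HasDerivAt.congr_deriv (f := e) h ?_
    change Complex.exp (-(I * x * z)) * -(I * 1 * z) = -(I * z) * Complex.exp (-(I * x * z))
    ring
  have hχd : ∀ x, HasDerivAt χ (deriv χ x) x := fun x =>
    (hχ.differentiable (by simp) x).hasDerivAt
  let φ : ℕ → ℝ → ℂ := fun n x => (χ (r n * x) : ℂ) * e x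
  have hφd : ∀ n x, HasDerivAt (φ n)
      (((r n * deriv χ (r n * x) : ℝ) : ℂ) * e x + (χ (r n * x) : ℂ) * (-(I * z) * e x)) x := by
    intro n x
    refine HasDerivAt.mul (HasDerivAt.ofReal_comp ?_) (hed x)
    have := (hχd (r n * x)).comp x ((hasDerivAt_id x).const_mul (r n))
    simpa [mul_comm, Function.comp_def] using this
  have hφ : ∀ n, ∫ x : ℝ, g x * deriv (φ n) x = -∫ x : ℝ, g' x * φ n x := by
    intro n
    refine hderiv (φ n) ?_ ?_
    · refine ContDiff.mul ?_ he
      exact Complex.ofRealCLM.contDiff.comp (hχ.comp (contDiff_const.mul contDiff_id))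
    · refine HasCompactSupport.mul_right (f' := e) ?_
      refine HasCompactSupport.comp_left (g := fun t : ℝ => (t : ℂ)) ?_ (by simp)
      exact hχs.comp_homeomorph (Homeomorph.mulLeft₀ (r n) (hr0 n))
  have hχlim : ∀ x, Filter.Tendsto (fun n => (χ (r n * x) : ℂ)) Filter.atTop (nhds 1) := by
    intro x
    have h1 : Filter.Tendsto (fun n => r n * x) Filter.atTop (nhds 0) := by
      simpa using hr.mul_const x
    have h2 := (Complex.continuous_ofReal.comp hχ.continuous).tendsto 0
    simpa [hχ0, Function.comp_def] using h2.comp h1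
  have hlim' : Filter.Tendsto (fun n => ∫ x : ℝ, g' x * φ n x) Filter.atTop
      (nhds (complexFT g' z)) := by
    refine tendsto_integral_of_dominated_convergence _ (fun n => ?_) hg'
      (fun n => .of_forall fun x => ?_) (.of_forall fun x => ?_)
    · refine hm'.mul (Continuous.aestronglyMeasurable ?_)
      exact (Complex.continuous_ofReal.comp (hχ.continuous.comp (by fun_prop))).mul he.continuous
    · calc ‖g' x * φ n x‖ = |χ (r n * x)| * ‖g' x * e x‖ := by
            simp only [φ, norm_mul, Complex.norm_real, Real.norm_eq_abs]; ring
        _ ≤ 1 * (‖g' x‖ * Real.exp (β * |x| / 2)) := by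
            gcongr
            · exact hχ1 _
            · exact norm_mul_exp_le hz x
        _ = _ := one_mul _
    · simpa [φ, e] using ((hχlim x).mul_const (e x)).const_mul (g' x)
  have hlim : Filter.Tendsto (fun n => ∫ x : ℝ, g x * deriv (φ n) x) Filter.atTop
      (nhds (∫ x : ℝ, g x * (-(I * z) * e x))) := by
    refine tendsto_integral_of_dominated_convergence
      (fun x => (K + ‖z‖) * (‖g x‖ * Real.exp (β * |x| / 2))) (fun n => ?_) (hg.const_mul _)
      (fun n => .of_forall fun x => ?_) (.of_forall fun x => ?_)
    · exact hm.mul (measurable_deriv _).aestronglyMeasurable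
    · rw [(hφd n x).deriv]
      have h1 : ‖g x * e x‖ ≤ ‖g x‖ * Real.exp (β * |x| / 2) := norm_mul_exp_le hz x
      have h2 : ‖((r n * deriv χ (r n * x) : ℝ) : ℂ) + (χ (r n * x) : ℂ) * -(I * z)‖
          ≤ K + ‖z‖ := by
        refine (norm_add_le _ _).trans (add_le_add ?_ ?_)
        · rw [Complex.norm_real, Real.norm_eq_abs, abs_mul]
          calc _ ≤ 1 * K := mul_le_mul (hr1 n) (hχK _) (abs_nonneg _) zero_le_one
            _ = K := one_mul K
        · rw [norm_mul, Complex.norm_real, Real.norm_eq_abs, norm_neg, norm_mul, norm_I, one_mul]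
          exact mul_le_of_le_one_left (norm_nonneg _) (hχ1 _)
      calc _ = ‖((r n * deriv χ (r n * x) : ℝ) : ℂ) + (χ (r n * x) : ℂ) * -(I * z)‖
            * ‖g x * e x‖ := by rw [← norm_mul]; congr 1; ring
        _ ≤ _ := mul_le_mul h2 h1 (norm_nonneg _) ((norm_nonneg _).trans h2)
    · have h1 : Filter.Tendsto (fun n => ((r n * deriv χ (r n * x) : ℝ) : ℂ))
          Filter.atTop (nhds 0) := by
        rw [← Complex.ofReal_zero]
        refine (Complex.continuous_ofReal.tendsto 0).comp ?_
        refine squeeze_zero_norm (a := fun n => |r n| * K) (fun n => ?_) ?_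
        · rw [Real.norm_eq_abs, abs_mul]
          gcongr
          exact hχK _
        · simpa using hr.abs.mul_const K
      simp only [fun n => (hφd n x).deriv]
      refine Filter.Tendsto.const_mul (g x) ?_
      simpa using (h1.mul_const (e x)).add ((hχlim x).mul_const (-(I * z) * e x))
  simp only [hφ] at hlim
  have h := tendsto_nhds_unique hlim hlim'.neg
  have h2 : ∫ x : ℝ, g x * (-(I * z) * e x) = -(I * z * complexFT g z) := by
    rw [complexFT, ← integral_const_mul, ← integral_neg]
    refine integral_congr_ae (.of_forall fun x => ?_)
    simp only [e]
    ring
  rw [h2] at h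
  exact neg_injective h

end ComplexFourier

section RadialIntegral

theorem aestronglyMeasurable_complexFT {α : Type*} [MeasurableSpace α] {μ : Measure α} [SFinite μ]
    {g : ℝ → ℂ} (hm : AEStronglyMeasurable g) {ζ : α → ℂ} (hζ : Measurable ζ) :
    AEStronglyMeasurable (fun p => complexFT g (ζ p)) μ := by
  refine AEStronglyMeasurable.integral_prod_right'
    (f := fun q : α × ℝ => g q.2 * Complex.exp (-(I * q.2 * ζ q.1))) ?_
  refine hm.comp_snd.mul (Measurable.aestronglyMeasurable ?_)
  fun_prop

theorem integral_div_one_add_sq_le {a : ℝ} :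
    IntegrableOn (fun s : ℝ => a / (1 + (a * s) ^ 2)) (Set.Ioc 0 1) ∧
      ∫ s in Set.Ioc (0 : ℝ) 1, a / (1 + (a * s) ^ 2) ≤ Real.pi / 2 := by
  have hc : Continuous fun s : ℝ => a / (1 + (a * s) ^ 2) :=
    continuous_const.div (by fun_prop) fun s => by positivity
  refine ⟨hc.integrableOn_Ioc, ?_⟩
  rw [← intervalIntegral.integral_of_le zero_le_one,
    intervalIntegral.integral_eq_sub_of_hasDerivAt (f := fun s => Real.arctan (a * s))
      (fun s _ => ?_) (hc.intervalIntegrable _ _)]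
  · simpa using (Real.arctan_lt_pi_div_two a).le
  · have := ((hasDerivAt_id s).const_mul a).arctan
    refine this.congr_deriv ?_
    simp only [id_eq]
    ring

/-- The integrals `∫₀¹ |θ̂(s z)| / s ds` are bounded uniformly on a strip. -/
theorem exists_radial_bound {β : ℝ} (hβ : 0 < β) {θ θ' : ℝ → ℂ}
    (hθmeas : AEStronglyMeasurable θ volume) (hθ'meas : AEStronglyMeasurable θ' volume)
    (hderiv : IsDistribDeriv θ θ')
    (hθint : Integrable (fun x : ℝ => ‖θ x‖ * Real.exp (β * |x| / 2)))
    (hθ'int : Integrable (fun x : ℝ => ‖θ' x‖ * Real.exp (β * |x| / 2)))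
    (hθmass : ∫ x : ℝ, θ x = 0) :
    ∃ C : ℝ, ∀ z : ℂ, |z.im| ≤ β / 2 →
      IntegrableOn (fun s : ℝ => complexFT θ (s * z) / s) (Set.Ioc 0 1) ∧
        ∫ s in Set.Ioc (0 : ℝ) 1, ‖complexFT θ (s * z) / s‖ ≤ C := by
  let C₀ : ℝ := ∫ x : ℝ, ‖θ x‖ * Real.exp (β * |x| / 2)
  let C₁ : ℝ := ∫ x : ℝ, ‖θ' x‖ * Real.exp (β * |x| / 2)
  have hC₀ : 0 ≤ C₀ := integral_nonneg fun x => by positivity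
  have hC₁ : 0 ≤ C₁ := integral_nonneg fun x => by positivity
  refine ⟨2 * C₀ + (C₁ + 4 / β * C₀) * (Real.pi / 2), fun z hz => ?_⟩
  have him : ∀ s : ℝ, 0 ≤ s → ((s : ℂ) * z).im = s * z.im := fun s _ => Complex.im_ofReal_mul s z
  have hpt : ∀ s ∈ Set.Ioc (0 : ℝ) 1, ‖complexFT θ (s * z) / s‖
      ≤ 2 * C₀ + (C₁ + 4 / β * C₀) * (‖z‖ / (1 + (‖z‖ * s) ^ 2)) := by
    rintro s ⟨hs0, hs1⟩
    have habs : |((s : ℂ) * z).im| = s * |z.im| := by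
      rw [him s hs0.le, abs_mul, abs_of_pos hs0]
    have hstrip : |((s : ℂ) * z).im| ≤ β / 2 := by
      rw [habs]
      exact (mul_le_of_le_one_left (abs_nonneg _) hs1).trans hz
    rw [norm_div, Complex.norm_real, Real.norm_of_nonneg hs0.le, div_le_iff₀ hs0]
    have hnn : 0 ≤ (C₁ + 4 / β * C₀) * (‖z‖ / (1 + (‖z‖ * s) ^ 2)) := by positivity
    have hn : ‖(s : ℂ) * z‖ = ‖z‖ * s := by
      rw [norm_mul, Complex.norm_real, Real.norm_of_nonneg hs0.le, mul_comm]
    rcases le_total s (1 / 2) with hs | hs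
    · have h1 := norm_complexFT_le_mul_norm hβ hθmeas hθint hθmass (z := s * z) (by
        rw [habs]
        calc s * |z.im| ≤ 1 / 2 * (β / 2) := by gcongr
          _ = _ := by ring)
      have h2 : ‖z‖ * s * ‖complexFT θ (s * z)‖ ≤ C₁ := by
        have h := mul_complexFT_eq hθmeas hθ'meas hderiv hθint hθ'int hstrip
        have h' := norm_complexFT_le hθ'int hstrip
        rwa [← h, norm_mul, norm_mul, norm_I, one_mul, hn] at h'
      rw [hn] at h1
      have h3 : ‖complexFT θ (s * z)‖ * (1 + (‖z‖ * s) ^ 2)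
          ≤ (C₁ + 4 / β * C₀) * (‖z‖ * s) := by
        have h4 : ‖z‖ * s * (‖z‖ * s * ‖complexFT θ (s * z)‖) ≤ ‖z‖ * s * C₁ := by gcongr
        have h5 : ‖complexFT θ (s * z)‖ ≤ 4 / β * C₀ * (‖z‖ * s) := h1
        linarith
      have h6 : ‖complexFT θ (s * z)‖
          ≤ (C₁ + 4 / β * C₀) * (‖z‖ / (1 + (‖z‖ * s) ^ 2)) * s := by
        rw [← le_div_iff₀ (by positivity)] at h3
        refine h3.trans (le_of_eq ?_)
        ring
      nlinarith
    · have h1 : ‖complexFT θ (s * z)‖ ≤ C₀ := norm_complexFT_le hθint hstrip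
      nlinarith
  obtain ⟨hi, hle⟩ := integral_div_one_add_sq_le (a := ‖z‖)
  have hbi : IntegrableOn (fun s : ℝ => 2 * C₀ + (C₁ + 4 / β * C₀) *
      (‖z‖ / (1 + (‖z‖ * s) ^ 2))) (Set.Ioc 0 1) := by
    refine Integrable.add ?_ (hi.const_mul _)
    exact integrable_const _
  have hae := (ae_restrict_iff' (μ := volume) (measurableSet_Ioc (a := (0 : ℝ)) (b := 1))).2
    (.of_forall hpt)
  have hmeas : AEStronglyMeasurable (fun s : ℝ => complexFT θ (s * z) / s)
      (volume.restrict (Set.Ioc 0 1)) :=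
    ((aestronglyMeasurable_complexFT hθmeas (by fun_prop)).aemeasurable.div
      (by fun_prop)).aestronglyMeasurable
  have hint : IntegrableOn (fun s : ℝ => complexFT θ (s * z) / s) (Set.Ioc 0 1) :=
    Integrable.mono' hbi hmeas hae
  refine ⟨hint, (integral_mono_ae hint.norm hbi hae).trans ?_⟩
  rw [integral_add (integrable_const _) (hi.const_mul _), integral_const_mul, integral_const_mul]
  have : ∫ _ in Set.Ioc (0 : ℝ) 1, C₀ = C₀ := by simp
  rw [this]
  gcongr

end RadialIntegral

section Multiplier

open scoped FourierTransform InnerProductSpace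

/-- The logarithm of the multiplier, `∫₀¹ θ̂(sz)/s ds`, at a complex frequency. -/
noncomputable def radialSymbol (θ : ℝ → ℂ) (z : ℂ) : ℂ :=
  ∫ s in Set.Ioc (0 : ℝ) 1, complexFT θ (s * z) / s

/-- The point of the horizontal line `Im z = a` with real part `2πη`. -/
noncomputable def lineFreq (a η : ℝ) : ℂ := 2 * Real.pi * η + I * a

theorem lineFreq_im (a η : ℝ) : (lineFreq a η).im = a := by
  simp [lineFreq]

theorem measurable_lineFreq (a : ℝ) : Measurable (lineFreq a) := by
  unfold lineFreq; fun_prop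

theorem exp_neg_I_mul_lineFreq (a η x s : ℝ) :
    Complex.exp (-(I * x * (s * lineFreq a η)))
      = Real.exp (a * (s * x)) * Complex.exp (-(I * (2 * Real.pi * η) * (s * x : ℝ))) := by
  rw [Complex.ofReal_exp, ← Complex.exp_add, lineFreq]
  congr 1
  push_cast
  linear_combination (-(x * s * a : ℂ)) * I_sq

variable {β : ℝ} {θ : ℝ → ℂ}

theorem aestronglyMeasurable_symbol (hm : AEStronglyMeasurable θ) (a : ℝ) (μ : Measure (ℝ × ℝ))
    [SFinite μ] :
    AEStronglyMeasurable (fun p : ℝ × ℝ => complexFT θ (p.2 * lineFreq a p.1) / p.2) μ := by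
  have h1 : Measurable fun p : ℝ × ℝ => (p.2 : ℂ) * lineFreq a p.1 :=
    (by fun_prop : Measurable fun p : ℝ × ℝ => (p.2 : ℂ)).mul
      ((measurable_lineFreq a).comp measurable_fst)
  have h2 : Measurable fun p : ℝ × ℝ => ((p.2 : ℂ))⁻¹ := by fun_prop
  simp only [div_eq_mul_inv]
  exact (aestronglyMeasurable_complexFT hm h1).mul h2.aestronglyMeasurable

theorem norm_radialSymbol_le {C : ℝ} {z : ℂ}
    (hC : ∫ s in Set.Ioc (0 : ℝ) 1, ‖complexFT θ (s * z) / s‖ ≤ C) : ‖radialSymbol θ z‖ ≤ C :=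
  (norm_integral_le_integral_norm _).trans hC

theorem memLp_radialSymbol (hm : AEStronglyMeasurable θ) {C : ℝ}
    (hC : ∀ z : ℂ, |z.im| ≤ β / 2 →
      IntegrableOn (fun s : ℝ => complexFT θ (s * z) / s) (Set.Ioc 0 1) ∧
        ∫ s in Set.Ioc (0 : ℝ) 1, ‖complexFT θ (s * z) / s‖ ≤ C)
    {a : ℝ} (ha : |a| ≤ β / 2) :
    MemLp (fun η => radialSymbol θ (lineFreq a η)) ∞ volume := by
  refine memLp_top_of_bound ?_ C (.of_forall fun η => norm_radialSymbol_le (hC _ ?_).2)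
  · exact AEStronglyMeasurable.integral_prod_right'
      (aestronglyMeasurable_symbol hm a (volume.prod (volume.restrict (Set.Ioc 0 1))))
  · rwa [lineFreq_im]

theorem integral_mul_radialSymbol (hm : AEStronglyMeasurable θ) {C : ℝ}
    (hC : ∀ z : ℂ, |z.im| ≤ β / 2 →
      IntegrableOn (fun s : ℝ => complexFT θ (s * z) / s) (Set.Ioc 0 1) ∧
        ∫ s in Set.Ioc (0 : ℝ) 1, ‖complexFT θ (s * z) / s‖ ≤ C)
    {a : ℝ} (ha : |a| ≤ β / 2) {P : ℝ → ℂ} (hP : Integrable P) :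
    IntegrableOn (fun s : ℝ => (∫ η, P η * complexFT θ (s * lineFreq a η)) / s) (Set.Ioc 0 1) ∧
      ∫ η, P η * radialSymbol θ (lineFreq a η)
        = ∫ s in Set.Ioc (0 : ℝ) 1, (∫ η, P η * complexFT θ (s * lineFreq a η)) / s := by
  have hC' := fun η => hC (lineFreq a η) (by rwa [lineFreq_im])
  have hint : Integrable
      (fun p : ℝ × ℝ => P p.1 * (complexFT θ (p.2 * lineFreq a p.1) / p.2))
      (volume.prod (volume.restrict (Set.Ioc (0 : ℝ) 1))) := by
    have hms := aestronglyMeasurable_symbol hm a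
      (volume.prod (volume.restrict (Set.Ioc (0 : ℝ) 1)))
    have hmp : AEStronglyMeasurable
        (fun p : ℝ × ℝ => P p.1 * (complexFT θ (p.2 * lineFreq a p.1) / p.2))
        (volume.prod (volume.restrict (Set.Ioc (0 : ℝ) 1))) :=
      hP.aestronglyMeasurable.comp_fst.mul hms
    refine (integrable_prod_iff hmp).2 ⟨.of_forall fun η => (hC' η).1.const_mul (P η), ?_⟩
    refine Integrable.mono' (hP.norm.mul_const C) hmp.norm.integral_prod_right'
      (.of_forall fun η => ?_)
    simp only [norm_mul]
    rw [integral_const_mul, Real.norm_of_nonneg (by positivity)]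
    exact mul_le_mul_of_nonneg_left (hC' η).2 (norm_nonneg _)
  have hs : ∀ s : ℝ, ∫ η, P η * (complexFT θ (s * lineFreq a η) / s)
      = (∫ η, P η * complexFT θ (s * lineFreq a η)) / s := fun s => by
    rw [← integral_div]
    simp only [mul_div_assoc]
  constructor
  · simpa only [hs, IntegrableOn] using hint.integral_prod_right
  · rw [← integral_congr_ae (.of_forall hs), ← integral_integral_swap hint]
    simp only [radialSymbol, integral_const_mul]

theorem integral_mul_complexFT_lineFreq (hm : AEStronglyMeasurable θ)
    (hθ : Integrable (fun x : ℝ => ‖θ x‖ * Real.exp (β * |x| / 2)))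
    {a : ℝ} (ha : |a| ≤ β / 2) {P : ℝ → ℂ} (hP : Integrable P) {s : ℝ}
    (hs : s ∈ Set.Ioc (0 : ℝ) 1) :
    Integrable (fun x : ℝ => θ x * (Real.exp (a * (s * x)) *
        ∫ η, P η * Complex.exp (-(I * (2 * Real.pi * η) * (s * x : ℝ))))) ∧
      ∫ η, P η * complexFT θ (s * lineFreq a η)
        = ∫ x : ℝ, θ x * (Real.exp (a * (s * x)) *
            ∫ η, P η * Complex.exp (-(I * (2 * Real.pi * η) * (s * x : ℝ)))) := by
  have hint : Integrable
      (fun p : ℝ × ℝ => P p.1 * (θ p.2 * Complex.exp (-(I * p.2 * (s * lineFreq a p.1)))))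
      (volume.prod volume) := by
    refine Integrable.mono' (hP.norm.mul_prod hθ) ?_ (.of_forall fun p => ?_)
    · have := measurable_lineFreq a
      exact hP.aestronglyMeasurable.comp_fst.mul
        (hm.comp_snd.mul (Measurable.aestronglyMeasurable (by fun_prop)))
    · rw [norm_mul]
      refine mul_le_mul_of_nonneg_left (norm_mul_exp_le ?_ _) (norm_nonneg _)
      rw [Complex.im_ofReal_mul, lineFreq_im, abs_mul,
        abs_of_pos hs.1]
      nlinarith [hs.2, hs.1, abs_nonneg a]
  have hx : ∀ x : ℝ,
      ∫ η, P η * (θ x * Complex.exp (-(I * x * (s * lineFreq a η))))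
        = θ x * (Real.exp (a * (s * x)) *
            ∫ η, P η * Complex.exp (-(I * (2 * Real.pi * η) * (s * x : ℝ)))) := fun x => by
    rw [← integral_const_mul, ← integral_const_mul]
    congr 1 with η
    rw [exp_neg_I_mul_lineFreq]
    ring
  constructor
  · simpa only [hx] using hint.integral_prod_right
  · rw [← integral_congr_ae (.of_forall hx), ← integral_integral_swap hint]
    simp only [complexFT, integral_const_mul]

/-- The operator on the weighted space obtained by multiplying the Fourier transform by `G` on the
line `Im z = a`. -/
noncomputable def lineOp {β a : ℝ} (ha : |a| ≤ β / 2) (G : ℝ → ℂ) (hG : MemLp G ∞ volume) :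
    Lp ℂ 2 (muE β) →L[ℂ] Lp ℂ 2 (muE β) :=
  let U : Lp ℂ 2 (muE β) →L[ℂ] Lp ℂ 2 (volume : Measure ℝ) :=
    ((Lp.fourierTransformₗᵢ ℝ ℂ).toContinuousLinearEquiv :
      Lp ℂ 2 (volume : Measure ℝ) →L[ℂ] Lp ℂ 2 (volume : Measure ℝ)) ∘L expWeight ha
  ContinuousLinearMap.adjoint U ∘L mulOp G hG ∘L U

theorem inner_lineOp {β a : ℝ} (ha : |a| ≤ β / 2) (G : ℝ → ℂ) (hG : MemLp G ∞ volume)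
    (e f : Lp ℂ 2 (muE β)) :
    inner ℂ e (lineOp ha G hG f) = ∫ η,
      (starRingEnd ℂ) ((𝓕 (expWeight ha e) : Lp ℂ 2 (volume : Measure ℝ)) η) *
        (𝓕 (expWeight ha f) : Lp ℂ 2 (volume : Measure ℝ)) η * G η := by
  rw [lineOp, ContinuousLinearMap.comp_apply, ContinuousLinearMap.adjoint_inner_right,
    L2.inner_def]
  apply integral_congr_ae
  filter_upwards [coeFn_mulOp G hG (𝓕 (expWeight ha f))] with η hη
  rw [RCLike.inner_apply']
  change (starRingEnd ℂ) ((𝓕 (expWeight ha e) : Lp ℂ 2 (volume : Measure ℝ)) η) *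
    (mulOp G hG (𝓕 (expWeight ha f))) η = _
  rw [hη]
  ring

theorem exp_mul_integral_fourier {β a : ℝ} (ha : |a| ≤ β / 2) (e f : Lp ℂ 2 (muE β)) (y : ℝ) :
    Integrable (fun t => (starRingEnd ℂ) (e t) * Real.exp (2 * a * t) * f (t - y)) ∧
    (Real.exp (a * y) : ℂ) * ∫ η,
      (starRingEnd ℂ) ((𝓕 (expWeight ha e) : Lp ℂ 2 (volume : Measure ℝ)) η) *
        (𝓕 (expWeight ha f) : Lp ℂ 2 (volume : Measure ℝ)) η *
          Complex.exp (-(I * (2 * Real.pi * η) * y))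
      = ∫ t, (starRingEnd ℂ) (e t) * Real.exp (2 * a * t) * f (t - y) := by
  have hae : (fun t => (Real.exp (a * y) : ℂ) *
      ((starRingEnd ℂ) (expWeight ha e t) * expWeight ha f (t - y))) =ᵐ[volume]
      fun t => (starRingEnd ℂ) (e t) * Real.exp (2 * a * t) * f (t - y) := by
    filter_upwards [coeFn_expWeight ha e,
      (measurePreserving_sub_right volume y).quasiMeasurePreserving.ae_eq_comp
        (coeFn_expWeight ha f)] with t h1 h2
    simp only [Function.comp_apply] at h2
    rw [h1, h2, map_mul, Complex.conj_ofReal]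
    have h3 : (Real.exp (2 * a * t) : ℂ)
        = Real.exp (a * y) * Real.exp (a * t) * Real.exp (a * (t - y)) := by
      rw [← Complex.ofReal_mul, ← Complex.ofReal_mul, ← Real.exp_add, ← Real.exp_add]
      congr 2
      ring
    rw [h3]
    ring
  constructor
  · refine Integrable.congr (Integrable.const_mul ?_ _) hae
    refine (L2.integrable_inner (𝕜 := ℂ) (expWeight ha e)
      (translateLp y (expWeight ha f))).congr ?_
    filter_upwards [coeFn_translateLp y (expWeight ha f)] with t ht
    rw [ht, RCLike.inner_apply']
  · rw [integral_fourier_mul_modulation, ← integral_const_mul, integral_congr_ae hae]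

end Multiplier

section LogOperator

open scoped FourierTransform

variable {β : ℝ} {θ : ℝ → ℂ}

theorem memLp_charVec (hβ : 0 < β) (ξ : ℝ) :
    MemLp (fun x : ℝ => Complex.exp (I * x * ξ) / (Real.cosh (β * x) : ℂ)) 2 (muE β) := by
  refine memLp_div_cosh (γ := 0) (C := 1) (by simpa using hβ)
    (Continuous.aestronglyMeasurable (by fun_prop)) fun x => ?_
  rw [Complex.norm_exp]
  simp

/-- The element of the weighted space representing evaluation of the Fourier transform at `ξ`. -/
noncomputable def charVec (hβ : 0 < β) (ξ : ℝ) : Lp ℂ 2 (muE β) := (memLp_charVec hβ ξ).toLp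

theorem conj_exp_I_mul (x ξ : ℝ) :
    (starRingEnd ℂ) (Complex.exp (I * x * ξ)) = Complex.exp (-(I * x * ξ)) := by
  rw [← Complex.exp_conj]
  simp

theorem inner_charVec (hβ : 0 < β) (ξ : ℝ) (f : Lp ℂ 2 (muE β)) :
    inner ℂ (charVec hβ ξ) f = FT f ξ := by
  rw [charVec, (inner_toLp_div_cosh (memLp_charVec hβ ξ) f).2, FT]
  simp only [conj_exp_I_mul]
  simp only [mul_comm]

theorem inner_lineOp_radialSymbol (hm : AEStronglyMeasurable θ)
    (hθ : Integrable (fun x : ℝ => ‖θ x‖ * Real.exp (β * |x| / 2))) {C : ℝ}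
    (hC : ∀ z : ℂ, |z.im| ≤ β / 2 →
      IntegrableOn (fun s : ℝ => complexFT θ (s * z) / s) (Set.Ioc 0 1) ∧
        ∫ s in Set.Ioc (0 : ℝ) 1, ‖complexFT θ (s * z) / s‖ ≤ C)
    {a : ℝ} (ha : |a| ≤ β / 2) (e f : Lp ℂ 2 (muE β)) :
    (∀ s ∈ Set.Ioc (0 : ℝ) 1, Integrable fun x : ℝ => θ x *
        ∫ t, (starRingEnd ℂ) (e t) * Real.exp (2 * a * t) * f (t - s * x)) ∧
      IntegrableOn (fun s : ℝ => (∫ x : ℝ, θ x *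
        ∫ t, (starRingEnd ℂ) (e t) * Real.exp (2 * a * t) * f (t - s * x)) / s) (Set.Ioc 0 1) ∧
      inner ℂ e (lineOp ha _ (memLp_radialSymbol hm hC ha) f)
        = ∫ s in Set.Ioc (0 : ℝ) 1, (∫ x : ℝ, θ x *
            ∫ t, (starRingEnd ℂ) (e t) * Real.exp (2 * a * t) * f (t - s * x)) / s := by
  have hP : Integrable fun η =>
      (starRingEnd ℂ) ((𝓕 (expWeight ha e) : Lp ℂ 2 (volume : Measure ℝ)) η) *
        (𝓕 (expWeight ha f) : Lp ℂ 2 (volume : Measure ℝ)) η := by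
    simpa only [RCLike.inner_apply'] using L2.integrable_inner (𝕜 := ℂ)
      (𝓕 (expWeight ha e) : Lp ℂ 2 (volume : Measure ℝ)) (𝓕 (expWeight ha f))
  have h1 := integral_mul_radialSymbol hm hC ha hP
  have h2 := fun s hs => integral_mul_complexFT_lineFreq hm hθ ha hP (s := s) hs
  have h3 := fun y => (exp_mul_integral_fourier ha e f y).2
  simp only [h3] at h2
  refine ⟨fun s hs => (h2 s hs).1, ?_, ?_⟩
  · refine h1.1.congr_fun (fun s hs => ?_) measurableSet_Ioc
    simp only [(h2 s hs).2]
  · rw [inner_lineOp]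
    refine h1.2.trans (setIntegral_congr_fun measurableSet_Ioc fun s hs => ?_)
    simp only [(h2 s hs).2]

theorem abs_neg_half_le (hβ : 0 < β) : |-(β / 2)| ≤ β / 2 := by
  rw [abs_neg, abs_of_pos (by positivity)]

theorem abs_half_le (hβ : 0 < β) : |β / 2| ≤ β / 2 := by
  rw [abs_of_pos (by positivity)]

theorem half_sum_shifted (hβ : 0 < β) (ξ y : ℝ) (f : Lp ℂ 2 (muE β)) :
    (∫ t, (starRingEnd ℂ) (charVec hβ ξ t) * Real.exp (2 * (β / 2) * t) * f (t - y)) +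
      (∫ t, (starRingEnd ℂ) (charVec hβ ξ t) * Real.exp (2 * (-(β / 2)) * t) * f (t - y))
      = 2 * (Complex.exp (-(I * y * ξ)) * FT f ξ) := by
  have hFT : FT f ξ = ∫ t : ℝ, f (t - y) * Complex.exp (-(I * (t - y : ℝ) * ξ)) :=
    (integral_sub_right_eq_self (fun t : ℝ => f t * Complex.exp (-(I * t * ξ))) y).symm
  rw [← integral_add (exp_mul_integral_fourier (abs_half_le hβ) _ f y).1
    (exp_mul_integral_fourier (abs_neg_half_le hβ) _ f y).1, hFT,
    ← integral_const_mul, ← integral_const_mul]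
  apply integral_congr_ae
  filter_upwards [(absolutelyContinuous_muE β).ae_eq (memLp_charVec hβ ξ).coeFn_toLp] with t ht
  have hc : (Real.cosh (β * t) : ℂ) ≠ 0 := by exact_mod_cast (Real.cosh_pos _).ne'
  have hs : (Real.exp (2 * (β / 2) * t) : ℂ) + Real.exp (2 * (-(β / 2)) * t)
      = 2 * Real.cosh (β * t) := by
    rw [Real.cosh_eq]
    push_cast
    ring_nf
  have he : Complex.exp (-(I * y * ξ)) * Complex.exp (-(I * (t - y : ℝ) * ξ))
      = Complex.exp (-(I * t * ξ)) := by
    rw [← Complex.exp_add]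
    push_cast
    ring_nf
  rw [charVec, ht, map_div₀, Complex.conj_ofReal, conj_exp_I_mul, ← add_mul, ← mul_add, hs, ← he]
  generalize (Real.cosh (β * t) : ℂ) = c at hc
  field_simp

/-- The bounded operator whose Fourier multiplier is the radial symbol of `θ`. -/
theorem exists_logOp (hβ : 0 < β) (hm : AEStronglyMeasurable θ)
    (hθ : Integrable (fun x : ℝ => ‖θ x‖ * Real.exp (β * |x| / 2))) {C : ℝ}
    (hC : ∀ z : ℂ, |z.im| ≤ β / 2 →
      IntegrableOn (fun s : ℝ => complexFT θ (s * z) / s) (Set.Ioc 0 1) ∧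
        ∫ s in Set.Ioc (0 : ℝ) 1, ‖complexFT θ (s * z) / s‖ ≤ C) :
    ∃ A : Lp ℂ 2 (muE β) →L[ℂ] Lp ℂ 2 (muE β),
      ∀ f ξ, FT (A f) ξ = radialSymbol θ ξ * FT f ξ := by
  refine ⟨(2 : ℂ)⁻¹ • (lineOp (abs_half_le hβ) _ (memLp_radialSymbol hm hC (abs_half_le hβ)) +
    lineOp (abs_neg_half_le hβ) _ (memLp_radialSymbol hm hC (abs_neg_half_le hβ))),
    fun f ξ => ?_⟩
  obtain ⟨i1, j1, k1⟩ :=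
    inner_lineOp_radialSymbol hm hθ hC (abs_half_le hβ) (charVec hβ ξ) f
  obtain ⟨i2, j2, k2⟩ :=
    inner_lineOp_radialSymbol hm hθ hC (abs_neg_half_le hβ) (charVec hβ ξ) f
  rw [← inner_charVec hβ, _root_.smul_apply, _root_.add_apply,
    inner_smul_right, inner_add_right, k1, k2, ← integral_add j1 j2, radialSymbol,
    ← integral_const_mul, ← integral_mul_const]
  refine setIntegral_congr_fun measurableSet_Ioc fun s hs => ?_
  have h : ∀ x : ℝ, θ x * (∫ t, (starRingEnd ℂ) (charVec hβ ξ t) *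
      Real.exp (2 * (β / 2) * t) * f (t - s * x)) + θ x * (∫ t, (starRingEnd ℂ) (charVec hβ ξ t) *
        Real.exp (2 * (-(β / 2)) * t) * f (t - s * x))
      = 2 * FT f ξ * (θ x * Complex.exp (-(I * x * (s * ξ : ℂ)))) := fun x => by
    rw [← mul_add, half_sum_shifted hβ ξ (s * x) f]
    push_cast
    ring_nf
  rw [← add_div, ← integral_add (i1 s hs) (i2 s hs), integral_congr_ae (.of_forall h),
    integral_const_mul, complexFT]
  ring

theorem FT_exp (hβ : 0 < β) {A : Lp ℂ 2 (muE β) →L[ℂ] Lp ℂ 2 (muE β)} {m : ℝ → ℂ}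
    (hA : ∀ f ξ, FT (A f) ξ = m ξ * FT f ξ) (f : Lp ℂ 2 (muE β)) (ξ : ℝ) :
    FT (NormedSpace.exp A f) ξ = Complex.exp (m ξ) * FT f ξ := by
  have hpow : ∀ n : ℕ, ∀ f, FT ((A ^ n) f) ξ = m ξ ^ n * FT f ξ := by
    intro n
    induction n with
    | zero => simp
    | succ n ih =>
      intro f
      rw [pow_succ, mul_apply_eq_comp, ih, hA]
      ring
  have h1 := (NormedSpace.exp_series_hasSum_exp' (𝕂 := ℂ) A).mapL
    ((innerSL ℂ (charVec hβ ξ)).comp (ContinuousLinearMap.apply ℂ (Lp ℂ 2 (muE β)) f))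
  have h2 := (NormedSpace.exp_series_hasSum_exp' (𝕂 := ℂ) (m ξ)).mul_right (FT f ξ)
  rw [← Complex.exp_eq_exp_ℂ] at h2
  have h3 : ∀ n : ℕ, ((innerSL ℂ (charVec hβ ξ)).comp
      (ContinuousLinearMap.apply ℂ (Lp ℂ 2 (muE β)) f)) ((n.factorial : ℂ)⁻¹ • A ^ n)
      = (n.factorial : ℂ)⁻¹ • m ξ ^ n * FT f ξ := fun n => by
    change inner ℂ (charVec hβ ξ) (((n.factorial : ℂ)⁻¹ • A ^ n) f) = _
    rw [_root_.smul_apply, inner_smul_right, inner_charVec, hpow, smul_eq_mul, mul_assoc]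
  simp only [h3] at h1
  rw [← inner_charVec hβ]
  exact h1.unique h2

theorem exp_comp_exp_neg (A : Lp ℂ 2 (muE β) →L[ℂ] Lp ℂ 2 (muE β)) (f : Lp ℂ 2 (muE β)) :
    NormedSpace.exp A (NormedSpace.exp (-A) f) = f := by
  have h : NormedSpace.exp A * NormedSpace.exp (-A) = 1 := by
    let : NormedAlgebra ℚ (Lp ℂ 2 (muE β) →L[ℂ] Lp ℂ 2 (muE β)) :=
      NormedAlgebra.restrictScalars ℚ ℂ _
    rw [← NormedSpace.exp_add_of_commute (Commute.neg_right (Commute.refl A)), add_neg_cancel,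
      NormedSpace.exp_zero]
  rw [← mul_apply_eq_comp, h, one_apply_eq_self]

end LogOperator

section Moments

variable {β : ℝ}

theorem abs_pow_le_mul_exp {b : ℝ} (hb : 0 < b) (k : ℕ) (x : ℝ) :
    |x| ^ k ≤ k.factorial / b ^ k * Real.exp (b * |x|) := by
  have h := Real.pow_div_factorial_le_exp (b * |x|) (by positivity) k
  rw [mul_pow, div_le_iff₀ (by positivity)] at h
  rw [div_mul_eq_mul_div, le_div_iff₀ (by positivity)]
  linarith

theorem integrable_pow_mul_exp_mul_norm (hβ : 0 < β) (f : Lp ℂ 2 (muE β)) (k : ℕ) :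
    Integrable fun x : ℝ => |x| ^ k * Real.exp (β / 8 * |x|) * ‖f x‖ := by
  have hw : MemLp (fun x : ℝ => ((|x| ^ k * Real.exp (β / 8 * |x|) : ℝ) : ℂ) /
      (Real.cosh (β * x) : ℂ)) 2 (muE β) := by
    refine memLp_div_cosh (γ := β / 4) (C := k.factorial / (β / 8) ^ k) (by linarith)
      (Continuous.aestronglyMeasurable (by fun_prop)) fun x => ?_
    rw [Complex.norm_real, Real.norm_of_nonneg (by positivity),
      show β / 4 * |x| = β / 8 * |x| + β / 8 * |x| by ring, Real.exp_add, ← mul_assoc]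
    gcongr
    exact abs_pow_le_mul_exp (by positivity) k x
  refine (inner_toLp_div_cosh hw f).1.norm.congr (.of_forall fun x => ?_)
  simp only
  rw [Complex.conj_ofReal, norm_mul, Complex.norm_real, Real.norm_of_nonneg (by positivity)]

theorem aestronglyMeasurable_Lp_muE (f : Lp ℂ 2 (muE β)) :
    AEStronglyMeasurable f (volume : Measure ℝ) :=
  (Lp.aestronglyMeasurable f).mono_ac (absolutelyContinuous_muE β)

theorem integrable_mul_pow (hβ : 0 < β) (f : Lp ℂ 2 (muE β)) (j : ℕ) :
    Integrable fun x : ℝ => f x * (x : ℂ) ^ j := by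
  refine (integrable_pow_mul_exp_mul_norm hβ f j).mono' ((aestronglyMeasurable_Lp_muE f).mul
    (Continuous.aestronglyMeasurable (by fun_prop))) (.of_forall fun x => ?_)
  rw [norm_mul, norm_pow, Complex.norm_real, Real.norm_eq_abs, mul_comm]
  gcongr
  exact le_mul_of_one_le_right (by positivity) (Real.one_le_exp (by positivity))

theorem norm_FT_sub_taylor_le (hβ : 0 < β) (f : Lp ℂ 2 (muE β)) (k : ℕ) {ξ : ℝ}
    (hξ : |ξ| ≤ β / 8) :
    ‖FT f ξ - ∑ j ∈ Finset.range k,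
        (-(I * ξ)) ^ j / j.factorial * ∫ x : ℝ, f x * (x : ℂ) ^ j‖
      ≤ |ξ| ^ k * ∫ x : ℝ, |x| ^ k * Real.exp (β / 8 * |x|) * ‖f x‖ := by
  have hF : Integrable fun x : ℝ => f x * Complex.exp (-(I * x * ξ)) := by
    refine (integrable_pow_mul_exp_mul_norm hβ f 0).mono' (aestronglyMeasurable_mul_exp
      (aestronglyMeasurable_Lp_muE f) ξ) (.of_forall fun x => ?_)
    rw [norm_mul, norm_exp_neg_I_mul, mul_comm]
    gcongr
    simp only [ofReal_im, mul_zero, Real.exp_zero, pow_zero, one_mul]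
    exact Real.one_le_exp (by positivity)
  have hS : ∀ j ∈ Finset.range k, Integrable fun x : ℝ =>
      (-(I * ξ)) ^ j / j.factorial * (f x * (x : ℂ) ^ j) :=
    fun j _ => (integrable_mul_pow hβ f j).const_mul _
  simp only [FT, ← integral_const_mul]
  rw [← integral_finsetSum _ hS, ← integral_sub hF (integrable_finsetSum _ hS)]
  refine norm_integral_le_of_norm_le ((integrable_pow_mul_exp_mul_norm hβ f k).const_mul _)
    (.of_forall fun x => ?_)
  have h := Complex.norm_exp_sub_sum_le_norm_mul_exp (-(I * x * ξ)) k
  have he : f x * Complex.exp (-(I * x * ξ)) - ∑ j ∈ Finset.range k,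
      (-(I * ξ)) ^ j / j.factorial * (f x * (x : ℂ) ^ j)
      = f x * (Complex.exp (-(I * x * ξ)) - ∑ m ∈ Finset.range k,
        (-(I * x * ξ)) ^ m / m.factorial) := by
    rw [mul_sub, Finset.mul_sum]
    congr 1
    refine Finset.sum_congr rfl fun j _ => ?_
    rw [show (-(I * x * ξ) : ℂ) = -(I * ξ) * x by ring, mul_pow]
    ring
  have hn : ‖(-(I * x * ξ) : ℂ)‖ = |x| * |ξ| := by simp
  rw [hn] at h
  rw [he, norm_mul]
  calc ‖f x‖ * _ ≤ ‖f x‖ * ((|x| * |ξ|) ^ k * Real.exp (β / 8 * |x|)) := by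
        refine mul_le_mul_of_nonneg_left (h.trans ?_) (norm_nonneg _)
        rw [mul_comm (β / 8)]
        gcongr
    _ = _ := by rw [mul_pow]; ring

theorem mem_Ek_iff (hβ : 0 < β) (f : Lp ℂ 2 (muE β)) (k : ℕ) :
    f ∈ Ek β k ↔ ∃ C : ℝ, ∀ ξ : ℝ, |ξ| ≤ β / 8 → ‖FT f ξ‖ ≤ C * |ξ| ^ k := by
  constructor
  · intro hf
    refine ⟨∫ x : ℝ, |x| ^ k * Real.exp (β / 8 * |x|) * ‖f x‖, fun ξ hξ => ?_⟩
    have h := norm_FT_sub_taylor_le hβ f k hξ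
    rwa [Finset.sum_eq_zero fun j hj => by rw [hf j (Finset.mem_range.1 hj), mul_zero],
      sub_zero, mul_comm] at h
  · rintro ⟨C, hC⟩ j
    induction j using Nat.strong_induction_on with
    | _ j ih =>
      intro hj
      set D := ∫ x : ℝ, |x| ^ (j + 1) * Real.exp (β / 8 * |x|) * ‖f x‖
      set M := ∫ x : ℝ, f x * (x : ℂ) ^ j
      obtain ⟨l, rfl⟩ : ∃ l, k = j + 1 + l := Nat.exists_eq_add_of_le hj
      have hC0 : 0 ≤ C := by
        have := (norm_nonneg _).trans (hC (β / 8) (abs_of_pos (by positivity)).le)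
        exact nonneg_of_mul_nonneg_left this (by positivity)
      have key : ∀ ξ : ℝ, 0 < ξ → ξ ≤ β / 8 →
          ‖M‖ ≤ j.factorial * (C * (β / 8) ^ l + D) * ξ := fun ξ h0 hξ => by
        have hξ' : |ξ| ≤ β / 8 := by rwa [abs_of_pos h0]
        have h1 := norm_FT_sub_taylor_le hβ f (j + 1) hξ'
        rw [Finset.sum_range_succ, Finset.sum_eq_zero fun i hi => by
          rw [ih i (Finset.mem_range.1 hi) ((Finset.mem_range.1 hi).trans hj), mul_zero],
          zero_add] at h1
        have h2 := hC ξ hξ'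
        have h3 := norm_sub_norm_le ((-(I * ξ)) ^ j / j.factorial * M) (FT f ξ)
        rw [norm_sub_rev] at h3
        have h4 : ‖(-(I * ξ) : ℂ) ^ j / j.factorial * M‖ = ξ ^ j / j.factorial * ‖M‖ := by
          simp [abs_of_pos h0]
        rw [h4] at h3
        rw [abs_of_pos h0] at h1 h2
        have h5 : C * ξ ^ (j + 1 + l) ≤ C * (β / 8) ^ l * ξ ^ (j + 1) := by
          rw [pow_add, mul_comm (ξ ^ (j + 1)), ← mul_assoc]
          gcongr
        have h6 : ξ ^ j / j.factorial * ‖M‖ ≤ (C * (β / 8) ^ l + D) * ξ ^ (j + 1) := by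
          linarith
        rw [div_mul_eq_mul_div, div_le_iff₀ (by positivity), pow_succ] at h6
        refine le_of_mul_le_mul_left (h6.trans_eq ?_) (pow_pos h0 j)
        ring
      have hlim : Filter.Tendsto (fun ξ : ℝ => j.factorial * (C * (β / 8) ^ l + D) * ξ)
          (nhdsWithin 0 (Set.Ioi 0)) (nhds 0) := by
        refine tendsto_nhdsWithin_of_tendsto_nhds ?_
        simpa using (continuous_const_mul (j.factorial * (C * (β / 8) ^ l + D))).tendsto (0 : ℝ)
      have hle : ‖M‖ ≤ 0 := by
        refine ge_of_tendsto hlim ?_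
        filter_upwards [Ioc_mem_nhdsGT (show (0 : ℝ) < β / 8 by positivity)] with ξ hξ
        exact key ξ hξ.1 hξ.2
      exact norm_le_zero_iff.1 hle

theorem mem_Ek_of_FT_eq_mul (hβ : 0 < β) {f g : Lp ℂ 2 (muE β)} {m : ℝ → ℂ} {K : ℝ}
    (hm : ∀ ξ, ‖m ξ‖ ≤ K) (h : ∀ ξ, FT g ξ = m ξ * FT f ξ) {k : ℕ} (hf : f ∈ Ek β k) :
    g ∈ Ek β k := by
  obtain ⟨C, hC⟩ := (mem_Ek_iff hβ f k).1 hf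
  refine (mem_Ek_iff hβ g k).2 ⟨K * C, fun ξ hξ => ?_⟩
  rw [h, norm_mul, mul_assoc]
  exact mul_le_mul (hm ξ) (hC ξ hξ) (norm_nonneg _) ((norm_nonneg _).trans (hm ξ))

end Moments

theorem psihat_eq_exp_radialSymbol (θ : ℝ → ℂ) (ξ : ℝ) :
    psihat θ ξ = Complex.exp (radialSymbol θ ξ) := by
  rw [psihat, intervalIntegral.integral_of_le zero_le_one, radialSymbol]
  congr 2 with s
  rw [← Complex.ofReal_mul, mul_comm]
  rfl

/-- there is a bounded operator `Ψ` on `ℰ` with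
`ℱ[Ψf] = ψ̂ · f̂` a.e.; it is a bijection, its inverse is the bounded operator with
`ℱ[Ψ⁻¹f] = f̂ / ψ̂` a.e., and `Ψ(ℰ_k) = ℰ_k` for all `k`. -/
theorem Psi_isomorphism (β : ℝ) (hβ : 0 < β) (θ θ' : ℝ → ℂ)
    (hθmeas : AEStronglyMeasurable θ volume)
    (hθ'meas : AEStronglyMeasurable θ' volume)
    (hderiv : IsDistribDeriv θ θ')
    (hθint : Integrable (fun x : ℝ => ‖θ x‖ * Real.exp (β * |x| / 2)))
    (hθ'int : Integrable (fun x : ℝ => ‖θ' x‖ * Real.exp (β * |x| / 2)))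
    (hθmass : ∫ x : ℝ, θ x = 0) :
    ∃ Ψ : Lp ℂ 2 (muE β) →L[ℂ] Lp ℂ 2 (muE β),
      (∀ f : Lp ℂ 2 (muE β),
        ∀ᵐ ξ : ℝ ∂volume, FT (Ψ f) ξ = psihat θ ξ * FT f ξ) ∧
      Function.Bijective Ψ ∧
      (∃ Φ : Lp ℂ 2 (muE β) →L[ℂ] Lp ℂ 2 (muE β),
        (∀ f, Φ (Ψ f) = f) ∧ (∀ f, Ψ (Φ f) = f) ∧
        ∀ f : Lp ℂ 2 (muE β),
          ∀ᵐ ξ : ℝ ∂volume, FT (Φ f) ξ = FT f ξ / psihat θ ξ) ∧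
      (∀ k : ℕ, Ψ '' Ek β k = Ek β k) := by
  obtain ⟨C, hC⟩ := exists_radial_bound hβ hθmeas hθ'meas hderiv hθint hθ'int hθmass
  obtain ⟨A, hA⟩ := exists_logOp hβ hθmeas hθint hC
  have hnegA : ∀ f ξ, FT ((-A) f) ξ = -radialSymbol θ ξ * FT f ξ := fun f ξ => by
    rw [← inner_charVec hβ, _root_.neg_apply, inner_neg_right, inner_charVec, hA, neg_mul]
  have hbound : ∀ ξ : ℝ, ‖radialSymbol θ ξ‖ ≤ C := fun ξ =>
    norm_radialSymbol_le (hC ξ (by simpa using by positivity)).2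
  have hexp : ∀ w : ℂ, ‖w‖ ≤ C → ‖Complex.exp w‖ ≤ Real.exp C := fun w hw =>
    (Complex.norm_exp_le_exp_norm w).trans (Real.exp_le_exp.2 hw)
  have hΨ := FT_exp hβ hA
  have hΦ := FT_exp hβ hnegA
  have hΨΦ := exp_comp_exp_neg A
  have hΦΨ : ∀ f, NormedSpace.exp (-A) (NormedSpace.exp A f) = f := fun f => by
    simpa only [neg_neg] using exp_comp_exp_neg (-A) f
  refine ⟨NormedSpace.exp A, fun f => .of_forall fun ξ => ?_,
    ⟨Function.LeftInverse.injective hΦΨ, Function.RightInverse.surjective hΨΦ⟩,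
    ⟨NormedSpace.exp (-A), hΦΨ, hΨΦ, fun f => .of_forall fun ξ => ?_⟩, fun k => ?_⟩
  · rw [psihat_eq_exp_radialSymbol, hΨ]
  · rw [psihat_eq_exp_radialSymbol, hΦ, Complex.exp_neg, div_eq_inv_mul]
  · refine Set.Subset.antisymm ?_ fun f hf => ⟨NormedSpace.exp (-A) f, ?_, hΨΦ f⟩
    · rintro _ ⟨f, hf, rfl⟩
      exact mem_Ek_of_FT_eq_mul hβ (fun ξ => hexp _ (hbound ξ)) (hΨ f) hf
    · exact mem_Ek_of_FT_eq_mul hβ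
        (fun ξ => hexp _ (by rw [norm_neg]; exact hbound ξ)) (hΦ f) hf
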